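/- For all integers ℓ ≥ 2, r ≥ 2 and m > r, D_r^smp(m; ℓ^r) ≥ R_r(m;ℓ). -/

import Mathlib

/-- The coloring `φ` of the `r`-element subsets of `[n]` admits a monochromatic
set `Y` of size `m`: all `r`-element subsets of `Y` get the same color. -/
def HasMonoClique (n r m ℓ : ℕ) (φ : Finset ℕ → Fin ℓ) : Prop :=
  ∃ Y : Finset ℕ, Y ⊆ Finset.range n ∧ Y.card = m ∧
    ∃ c : Fin ℓ, ∀ P ⊆ Y, P.card = r → φ P = c

/-- `R_r(m;ℓ)`: the classical hypergraph Ramsey number. -/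
noncomputable def ramsey (r m ℓ : ℕ) : ℕ :=
  sInf {n | ∀ φ : Finset ℕ → Fin ℓ, HasMonoClique n r m ℓ φ}

/-- The coloring `φ` of subsets of `[n]` admits a monochromatic *simple* `(r,m)`-daisy:
disjoint sets `K, M ⊆ [n]` with `|M| = m`, where every element of `K` is either below
all of `M` or above all of `M`, such that `φ` is constant on `{K ∪ P : P ⊆ M, |P| = r}`. -/
def HasMonoSimpleDaisy (n r m ℓ : ℕ) (φ : Finset ℕ → Fin ℓ) : Prop :=
  ∃ K M : Finset ℕ, K ⊆ Finset.range n ∧ M ⊆ Finset.range n ∧ Disjoint K M ∧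
    M.card = m ∧ (∀ x ∈ K, (∀ y ∈ M, x < y) ∨ (∀ y ∈ M, y < x)) ∧
    ∃ c : Fin ℓ, ∀ P ⊆ M, P.card = r → φ (K ∪ P) = c

/-- `D_r^smp(m;ℓ)`: the least `n` such that every `ℓ`-coloring of the subsets of `[n]`
admits a monochromatic simple `(r,m)`-daisy. -/
noncomputable def simpleDaisyRamsey (r m ℓ : ℕ) : ℕ :=
  sInf {n | ∀ φ : Finset ℕ → Fin ℓ, HasMonoSimpleDaisy n r m ℓ φ}

theorem ramsey_aux (ℓ r : ℕ) : ∀ m : ℕ, ∃ n : ℕ, ∀ S : Finset ℕ, n ≤ S.card →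
    ∀ φ : Finset ℕ → Fin ℓ, ∃ Y ⊆ S, Y.card = m ∧
      ∃ c : Fin ℓ, ∀ P ⊆ Y, P.card = r → φ P = c := by
  induction r with
  | zero =>
    intro m
    refine ⟨m, fun S hS φ => ?_⟩
    obtain ⟨Y, hY, hc⟩ := Finset.exists_subset_card_eq hS
    refine ⟨Y, hY, hc, φ ∅, fun P _ h => ?_⟩
    rw [Finset.card_eq_zero.mp h]
  | succ r ih =>
    have claim : ∀ t : ℕ, ∃ n : ℕ, ∀ S : Finset ℕ, n ≤ S.card →
        ∀ φ : Finset ℕ → Fin ℓ, ∃ Y ⊆ S, Y.card = t ∧ ∃ g : ℕ → Fin ℓ,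
          ∀ x ∈ Y, ∀ P ⊆ Y, (∀ y ∈ P, x < y) → P.card = r → φ (insert x P) = g x := by
      intro t
      induction t with
      | zero =>
        exact ⟨0, fun S _ φ => ⟨∅, by simp, by simp, fun _ => φ ∅, by simp⟩⟩
      | succ t iht =>
        obtain ⟨n1, h1⟩ := iht
        obtain ⟨n2, h2⟩ := ih n1
        refine ⟨n2 + 1, fun S hS φ => ?_⟩
        have hne : S.Nonempty := Finset.card_pos.mp (by omega)
        obtain ⟨Y1, hY1, hc1, c, hc⟩ := h2 (S.erase (S.min' hne))
          (by rw [Finset.card_erase_of_mem (Finset.min'_mem _ _)]; omega)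
          (fun P => φ (insert (S.min' hne) P))
        obtain ⟨Y2, hY2, hc2, g, hg⟩ := h1 Y1 hc1.ge φ
        have hlt : ∀ y ∈ Y2, S.min' hne < y := fun y hy =>
          Finset.min'_lt_of_mem_erase_min' _ _ (hY1 (hY2 hy))
        have hnot : S.min' hne ∉ Y2 := fun h => lt_irrefl _ (hlt _ h)
        refine ⟨insert (S.min' hne) Y2, ?_, ?_, Function.update g (S.min' hne) c, ?_⟩
        · refine Finset.insert_subset (Finset.min'_mem _ _) ?_
          exact (hY2.trans hY1).trans (Finset.erase_subset _ _)
        · rw [Finset.card_insert_of_notMem hnot, hc2]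
        · intro x hx P hP hxP hPc
          have hP2 : P ⊆ Y2 := by
            intro y hy
            rcases Finset.mem_insert.mp (hP hy) with h | h
            · exfalso
              have := hxP y hy
              rcases Finset.mem_insert.mp hx with h' | h'
              · omega
              · have := hlt x h'
                omega
            · exact h
          rcases Finset.mem_insert.mp hx with h | h
          · rw [h, Function.update_self]
            exact hc P (hP2.trans hY2) hPc
          · have hxne : x ≠ S.min' hne := by
              intro e
              rw [e] at h
              exact hnot h
            rw [Function.update_of_ne hxne]
            exact hg x h P hP2 hxP hPc
    intro m
    obtain ⟨n, hn⟩ := claim (ℓ * m)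
    refine ⟨n, fun S hS φ => ?_⟩
    obtain ⟨Y, hY, hYc, g, hg⟩ := hn S hS φ
    obtain ⟨c, -, hc⟩ := Finset.exists_le_card_fiber_of_mul_le_card_of_maps_to
      (s := Y) (t := (Finset.univ : Finset (Fin ℓ))) (f := g) (n := m)
      (fun _ _ => Finset.mem_univ _) ⟨φ ∅, Finset.mem_univ _⟩ (by simp [hYc])
    obtain ⟨Z, hZ, hZc⟩ := Finset.exists_subset_card_eq hc
    refine ⟨Z, (hZ.trans (Finset.filter_subset _ _)).trans hY, hZc, c, fun P hP hPc => ?_⟩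
    have hne : P.Nonempty := Finset.card_pos.mp (by omega)
    have hmem := Finset.min'_mem P hne
    have hx := Finset.mem_filter.mp (hZ (hP hmem))
    have := hg (P.min' hne) hx.1 (P.erase (P.min' hne))
      (fun y hy => (Finset.mem_filter.mp (hZ (hP (Finset.mem_of_mem_erase hy)))).1)
      (fun y hy => Finset.min'_lt_of_mem_erase_min' _ _ hy)
      (by rw [Finset.card_erase_of_mem hmem]; omega)
    rw [Finset.insert_erase hmem] at this
    rw [this, hx.2]

theorem block_eq (r j : ℕ) (A P Q B : List ℕ) (hP : P.length = r) (hQ : Q.length = r)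
    (h : j + r ≤ A.length ∨ A.length + r ≤ j) :
    ((A ++ (P ++ B)).drop j).take r = ((A ++ (Q ++ B)).drop j).take r := by
  rcases h with h | h
  · rw [List.drop_append_of_le_length (by omega), List.drop_append_of_le_length (by omega),
      List.take_append_of_le_length (by simp; omega),
      List.take_append_of_le_length (by simp; omega)]
  · simp only [List.drop_append]
    rw [List.drop_eq_nil_of_le (show P.length ≤ j - A.length by omega),
      List.drop_eq_nil_of_le (show Q.length ≤ j - A.length by omega), hP, hQ]

theorem sort_union (A P B : Finset ℕ) (h1 : ∀ x ∈ A, ∀ y ∈ P, x < y)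
    (h2 : ∀ x ∈ A, ∀ y ∈ B, x < y) (h3 : ∀ x ∈ P, ∀ y ∈ B, x < y) :
    (A ∪ P ∪ B).sort = A.sort ++ (P.sort ++ B.sort) := by
  have hs : (A.sort ++ (P.sort ++ B.sort)).SortedLT := by
    rw [List.sortedLT_iff_pairwise]
    simp only [List.pairwise_append, List.mem_append, Finset.mem_sort]
    refine ⟨(Finset.sortedLT_sort A).pairwise, ⟨(Finset.sortedLT_sort P).pairwise,
      (Finset.sortedLT_sort B).pairwise, h3⟩, ?_⟩
    rintro a ha b (hb | hb)
    · exact h1 a ha b hb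
    · exact h2 a ha b hb
  refine List.Perm.eq_of_sortedLE (Finset.sortedLT_sort _).sortedLE hs.sortedLE ?_
  rw [List.perm_ext_iff_of_nodup (Finset.sort_nodup _ _) hs.nodup]
  intro a
  simp

/-- Sum of the colors of the consecutive blocks of length `r` starting at positions `≡ i`. -/
def blockSum (n r ℓ : ℕ) [NeZero ℓ] (ψ : Finset ℕ → Fin ℓ) (i : ℕ) (X : Finset ℕ) : Fin ℓ :=
  ∑ k ∈ Finset.range n, ψ ((X.sort.drop (i + k * r)).take r).toFinset

theorem daisy_to_clique (n r m ℓ : ℕ) [NeZero ℓ] (hr : 2 ≤ r) (hm : r < m)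
    (h : ∀ φ : Finset ℕ → Fin (ℓ ^ r), HasMonoSimpleDaisy n r m (ℓ ^ r) φ)
    (ψ : Finset ℕ → Fin ℓ) : HasMonoClique n r m ℓ ψ := by
  obtain ⟨K, M, hK, hM, hd, hMc, hs, c, hc⟩ := h (fun X =>
    finFunctionFinEquiv (fun i : Fin r => blockSum n r ℓ ψ i X))
  refine ⟨M, hM, hMc, ?_⟩
  have hMne : M.Nonempty := Finset.card_pos.mp (by omega)
  obtain ⟨y0, hy0⟩ := hMne
  set A := K.filter (fun x => x < y0) with hA
  set B := K.filter (fun x => ¬ x < y0) with hB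
  have hAM : ∀ x ∈ A, ∀ y ∈ M, x < y := by
    intro x hx
    obtain ⟨hx1, hx2⟩ := Finset.mem_filter.mp hx
    rcases hs x hx1 with h | h
    · exact h
    · have := h y0 hy0
      omega
  have hMB : ∀ x ∈ M, ∀ y ∈ B, x < y := by
    intro y hy x hx
    obtain ⟨hx1, hx2⟩ := Finset.mem_filter.mp hx
    rcases hs x hx1 with h | h
    · exact absurd (h y0 hy0) hx2
    · exact h y hy
  have hAB : ∀ x ∈ A, ∀ y ∈ B, x < y := fun x hx y hy =>
    (hAM x hx y0 hy0).trans (hMB y0 hy0 y hy)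
  have hsort : ∀ P ⊆ M, (K ∪ P).sort = A.sort ++ (P.sort ++ B.sort) := by
    intro P hP
    rw [← sort_union A P B (fun x hx y hy => hAM x hx y (hP hy)) hAB
      (fun x hx y hy => hMB x (hP hx) y hy)]
    congr 1
    have : A ∪ B = K := Finset.filter_union_filter_not_eq _ _
    rw [← this, Finset.union_right_comm]
  have hAn : A.card < n := by
    have h1 : A ⊂ Finset.range n := by
      refine (Finset.ssubset_iff_of_subset ((Finset.filter_subset _ _).trans hK)).mpr
        ⟨y0, hM hy0, fun h => lt_irrefl _ (hAM y0 h y0 hy0)⟩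
    simpa using Finset.card_lt_card h1
  have hr0 : 0 < r := by omega
  have hk0 : A.card / r ∈ Finset.range n :=
    Finset.mem_range.mpr (lt_of_le_of_lt (Nat.div_le_self _ _) hAn)
  have key : ∀ P ⊆ M, P.card = r → ∀ Q ⊆ M, Q.card = r → ψ P = ψ Q := by
    intro P hP hPc Q hQ hQc
    have e := finFunctionFinEquiv.injective ((hc P hP hPc).trans (hc Q hQ hQc).symm)
    have e1 := congrFun e ⟨A.card % r, Nat.mod_lt _ hr0⟩
    simp only [blockSum, hsort P hP, hsort Q hQ] at e1
    rw [← Finset.add_sum_erase _ _ hk0, ← Finset.add_sum_erase _ _ hk0] at e1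
    have hrest : ∀ k ∈ (Finset.range n).erase (A.card / r),
        ψ (((A.sort ++ (P.sort ++ B.sort)).drop (A.card % r + k * r)).take r).toFinset =
        ψ (((A.sort ++ (Q.sort ++ B.sort)).drop (A.card % r + k * r)).take r).toFinset := by
      intro k hk
      refine congrArg (fun L : List ℕ => ψ L.toFinset)
        (block_eq r _ _ _ _ _ (by simpa using hPc) (by simpa using hQc) ?_)
      have hne := (Finset.mem_erase.mp hk).1
      have hdm := Nat.mod_add_div A.card r
      rw [mul_comm] at hdm
      rw [Finset.length_sort]
      rcases lt_or_gt_of_ne hne with h | h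
      · left
        have := Nat.mul_le_mul_right r (Nat.succ_le_of_lt h)
        rw [Nat.succ_mul] at this
        omega
      · right
        have := Nat.mul_le_mul_right r (Nat.succ_le_of_lt h)
        rw [Nat.succ_mul] at this
        omega
    rw [Finset.sum_congr rfl hrest] at e1
    have e2 := add_right_cancel e1
    have hpos : A.card % r + A.card / r * r = A.sort.length := by
      rw [Finset.length_sort, mul_comm, Nat.mod_add_div]
    have hblock : ∀ R : Finset ℕ, R.card = r →
        (((A.sort ++ (R.sort ++ B.sort)).drop (A.card % r + A.card / r * r)).take r).toFinset
          = R := by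
      intro R hR
      rw [hpos, List.drop_left, List.take_left' (by simpa using hR), Finset.sort_toFinset]
    rwa [hblock P hPc, hblock Q hQc] at e2
  obtain ⟨P0, hP0, hP0c⟩ := Finset.exists_subset_card_eq (show r ≤ M.card by omega)
  exact ⟨ψ P0, fun P hP hPc => key P hP hPc P0 hP0 hP0c⟩

/-- For all integers `ℓ ≥ 2`, `r ≥ 2` and `m > r`,
`D_r^smp(m; ℓ^r) ≥ R_r(m; ℓ)`. -/
theorem simpleDaisyRamsey_ge_ramsey (ℓ r m : ℕ) (hℓ : 2 ≤ ℓ) (hr : 2 ≤ r) (hm : r < m) :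
    ramsey r m ℓ ≤ simpleDaisyRamsey r m (ℓ ^ r) := by
  have : NeZero ℓ := ⟨by omega⟩
  have hne : {n | ∀ φ : Finset ℕ → Fin (ℓ ^ r),
      HasMonoSimpleDaisy n r m (ℓ ^ r) φ}.Nonempty := by
    obtain ⟨n, hn⟩ := ramsey_aux (ℓ ^ r) r m
    refine ⟨n, fun φ => ?_⟩
    obtain ⟨Y, hY, hYc, c, hc⟩ := hn (Finset.range n) (by simp) φ
    exact ⟨∅, Y, by simp, hY, by simp, hYc, by simp, c, fun P hP hPc => by
      rw [Finset.empty_union]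
      exact hc P hP hPc⟩
  exact Nat.sInf_le (daisy_to_clique _ r m ℓ hr hm (Nat.sInf_mem hne))
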